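/- arXiv:2604.19378 — 2 statements merged into one kernel-verified Lean document; each statement's English description precedes it below -/
import Mathlib

section
/- Let d ≥ 1, let T be a d×d real matrix with nonnegative entries whose row sums are all strictly less than 1, set e the all-ones vector in ℝ^d and t = (I_d − T)e. Let P = diag(p_1,…,p_d) with p_i ∈ [0,1], and let θ1, θ2 ∈ [0,1]. Set D = (I_d − P)θ2 + Pθ1, let Δ be the 2d×2d diagonal matrix whose first d diagonal entries equal θ2 and whose last d diagonal entries equal θ1, and let B_b = [[T(I_d−P), TP],[T(I_d−P), TP]] (2d×2d block matrix). Then I_d − TD and I_{2d} − B_b Δ are invertible, and for every π ∈ ℝ^d, writing β = ((I_d−P)π, Pπ) ∈ ℝ^{2d} and b = (t, t) ∈ ℝ^{2d}, one has β^⊤ Δ (I_{2d} − B_b Δ)^{−1} b = π^⊤ D (I_d − TD)^{−1} t. -/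
open Matrix

/-- A nonnegative matrix with row sums less than one is a strict contraction, so `1 - A` is
invertible. -/
theorem Matrix.isUnit_one_sub_of_sum_row_lt_one {n : Type*} [Fintype n] [DecidableEq n]
    {A : Matrix n n ℝ} (h0 : ∀ i j, 0 ≤ A i j) (h1 : ∀ i, ∑ j, A i j < 1) :
    IsUnit (1 - A) := by
  rw [Matrix.isUnit_iff_isUnit_det, isUnit_iff_ne_zero]
  refine det_ne_zero_of_sum_row_lt_diag fun k => ?_
  have hsum := Finset.add_sum_erase Finset.univ (A k) (Finset.mem_univ k)
  have hoff : ∑ j ∈ Finset.univ.erase k, ‖(1 - A) k j‖ = ∑ j ∈ Finset.univ.erase k, A k j := by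
    refine Finset.sum_congr rfl fun j hj => ?_
    rw [Matrix.sub_apply, Matrix.one_apply_ne (Finset.ne_of_mem_erase hj).symm, zero_sub,
      norm_neg, Real.norm_of_nonneg (h0 k j)]
  rw [hoff, Matrix.sub_apply, Matrix.one_apply_eq]
  linarith [h1 k, Real.le_norm_self (1 - A k k)]

/-- Scaling the columns of a nonnegative matrix by factors in `[0, 1]` keeps its row sums below
one, so `1 - A * diagonal w` is invertible. -/
theorem Matrix.isUnit_one_sub_mul_diagonal {n : Type*} [Fintype n] [DecidableEq n]
    {A : Matrix n n ℝ} (h0 : ∀ i j, 0 ≤ A i j) (h1 : ∀ i, ∑ j, A i j < 1)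
    {w : n → ℝ} (hw : ∀ i, w i ∈ Set.Icc (0 : ℝ) 1) :
    IsUnit (1 - A * Matrix.diagonal w) := by
  refine isUnit_one_sub_of_sum_row_lt_one (fun i j => ?_) fun i => ?_
  · rw [Matrix.mul_diagonal]
    exact mul_nonneg (h0 i j) (hw j).1
  · refine lt_of_le_of_lt (Finset.sum_le_sum fun j _ => ?_) (h1 i)
    rw [Matrix.mul_diagonal]
    exact mul_le_of_le_one_right (h0 i j) (hw j).2

/-- Theorem 1 (Bernoulli rewards), matrix/PGF form: the expanded-chain PGF
`β^⊤ Δ (I − B_b Δ)^{−1} b` equals the compact form `π^⊤ D (I − TD)^{−1} t`. -/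
theorem bernoulli_rrdph_pgf
    (d : ℕ) (hd : 1 ≤ d)
    (T : Matrix (Fin d) (Fin d) ℝ)
    (hT0 : ∀ i j, 0 ≤ T i j)
    (hTrow : ∀ i, ∑ j, T i j < 1)
    (p : Fin d → ℝ) (hp : ∀ i, p i ∈ Set.Icc (0 : ℝ) 1)
    (θ1 θ2 : ℝ) (hθ1 : θ1 ∈ Set.Icc (0 : ℝ) 1) (hθ2 : θ2 ∈ Set.Icc (0 : ℝ) 1)
    (P : Matrix (Fin d) (Fin d) ℝ) (hP : P = Matrix.diagonal p)
    (t : Fin d → ℝ) (ht : t = (1 - T).mulVec 1)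
    (D : Matrix (Fin d) (Fin d) ℝ) (hD : D = θ2 • (1 - P) + θ1 • P)
    (Δ : Matrix (Fin d ⊕ Fin d) (Fin d ⊕ Fin d) ℝ)
    (hΔ : Δ = Matrix.diagonal (Sum.elim (fun _ => θ2) (fun _ => θ1)))
    (Bb : Matrix (Fin d ⊕ Fin d) (Fin d ⊕ Fin d) ℝ)
    (hBb : Bb = Matrix.fromBlocks (T * (1 - P)) (T * P) (T * (1 - P)) (T * P)) :
    IsUnit (1 - T * D) ∧ IsUnit (1 - Bb * Δ) ∧
      ∀ π : Fin d → ℝ,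
        Sum.elim ((1 - P).mulVec π) (P.mulVec π) ⬝ᵥ
            (Δ * (1 - Bb * Δ)⁻¹).mulVec (Sum.elim t t)
          = π ⬝ᵥ (D * (1 - T * D)⁻¹).mulVec t := by
  have hD' : D = Matrix.diagonal fun i => (1 - p i) * θ2 + p i * θ1 := by
    rw [hD, hP]
    ext i j
    by_cases hij : i = j
    · subst hij
      simp [mul_comm]
    · simp [hij]
  have hTD : IsUnit (1 - T * D) := by
    rw [hD']
    exact Matrix.isUnit_one_sub_mul_diagonal hT0 hTrow fun i =>
      (convex_Icc (0 : ℝ) 1) hθ2 hθ1 (sub_nonneg.mpr (hp i).2) (hp i).1 (by ring)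
  have hΔ' : Δ = Matrix.fromBlocks (θ2 • 1) 0 0 (θ1 • 1) := by
    rw [hΔ, ← Matrix.fromBlocks_diagonal]
    simp [Matrix.smul_one_eq_diagonal]
  have hBbΔ : Bb * Δ =
      Matrix.fromRows T T * Matrix.fromCols (θ2 • (1 - P)) (θ1 • P) := by
    rw [hBb, hΔ', Matrix.fromBlocks_multiply, Matrix.fromRows_mul_fromCols]
    simp
  have hunit : IsUnit (1 - Bb * Δ) := by
    rw [Matrix.isUnit_iff_isUnit_det] at hTD ⊢
    rwa [hBbΔ, Matrix.det_one_sub_mul_comm, Matrix.fromCols_mul_fromRows, ← Matrix.add_mul, ← hD,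
      Matrix.det_one_sub_mul_comm]
  refine ⟨hTD, hunit, fun π => ?_⟩
  set x := (1 - T * D)⁻¹ *ᵥ t with hx
  have hxt : (1 - T * D) *ᵥ x = t := by
    rw [hx, Matrix.mulVec_mulVec, Matrix.mul_nonsing_inv _ ((Matrix.isUnit_iff_isUnit_det _).mp hTD),
      Matrix.one_mulVec]
  have hxx : (1 - Bb * Δ) *ᵥ Sum.elim x x = Sum.elim t t := by
    rw [Matrix.sub_mulVec, Matrix.one_mulVec, hBbΔ, ← Matrix.mulVec_mulVec,
      Matrix.fromCols_mulVec_sumElim, ← Matrix.add_mulVec, ← hD, Matrix.fromRows_mulVec,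
      Matrix.mulVec_mulVec, ← hxt, Matrix.sub_mulVec, Matrix.one_mulVec]
    ext (i | i) <;> rfl
  have hinv : (1 - Bb * Δ)⁻¹ *ᵥ Sum.elim t t = Sum.elim x x := by
    rw [← hxx, Matrix.mulVec_mulVec,
      Matrix.nonsing_inv_mul _ ((Matrix.isUnit_iff_isUnit_det _).mp hunit), Matrix.one_mulVec]
  rw [← Matrix.mulVec_mulVec, hinv, ← Matrix.mulVec_mulVec, ← hx, hΔ, hD', hP]
  simp only [dotProduct, Fintype.sum_sum_type, Sum.elim_inl, Sum.elim_inr, Matrix.mulVec_diagonal,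
    Matrix.sub_mulVec, Matrix.one_mulVec, Pi.sub_apply, ← Finset.sum_add_distrib]
  exact Finset.sum_congr rfl fun i _ => by ring
end

section
/- Let d ≥ 1, let T be a d×d real matrix with nonnegative entries whose row sums are all strictly less than 1, set e the all-ones vector in ℝ^d and t = (I_d − T)e. Let Q = diag(q_1,…,q_d) with q_i ∈ (0,1], and let θ1 ∈ [0,1), θ2 ∈ [0,1]. Let Δ be the 2d×2d diagonal matrix whose first d diagonal entries equal θ2 and whose last d diagonal entries equal θ1, and let B_g = [[QT, I_d−Q],[QT, I_d−Q]] (2d×2d block matrix). Then I_d − (QTθ2 + (I_d−Q)θ1) and I_{2d} − B_g Δ are invertible, and for every π ∈ ℝ^d, writing β = (π, 0) ∈ ℝ^{2d} and b = (Qt, Qt) ∈ ℝ^{2d}, one has β^⊤ Δ (I_{2d} − B_g Δ)^{−1} b = θ2 · π^⊤ (I_d − (QTθ2 + (I_d−Q)θ1))^{−1} Q t. -/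
open Matrix

/-- A nonnegative real matrix with all row sums less than one is strictly substochastic,
so `1 - A` is invertible. -/
theorem Matrix.isUnit_one_sub_of_row_sum_lt_one {n : Type*} [Fintype n] [DecidableEq n]
    {A : Matrix n n ℝ} (hA : ∀ i j, 0 ≤ A i j) (hrow : ∀ i, ∑ j, A i j < 1) :
    IsUnit (1 - A) := by
  rw [Matrix.isUnit_iff_isUnit_det, isUnit_iff_ne_zero]
  refine det_ne_zero_of_sum_row_lt_diag fun k => ?_
  have hoff : ∑ j ∈ Finset.univ.erase k, ‖(1 - A) k j‖ = ∑ j ∈ Finset.univ.erase k, A k j := by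
    refine Finset.sum_congr rfl fun j hj => ?_
    have hkj : k ≠ j := (Finset.ne_of_mem_erase hj).symm
    simp [Matrix.one_apply_ne hkj, abs_of_nonneg (hA k j)]
  have hsum := Finset.add_sum_erase Finset.univ (fun j => A k j) (Finset.mem_univ k)
  rw [hoff, Real.norm_eq_abs]
  refine lt_of_lt_of_le ?_ (le_abs_self _)
  simp only [Matrix.sub_apply, Matrix.one_apply_eq]
  linarith [hrow k]

/-- Theorem 2 (geometric rewards), first half: the expanded-chain PGF
`β^⊤ Δ (I − B_g Δ)^{−1} b` equals `θ2 · π^⊤ (I − (QTθ2 + (I−Q)θ1))^{−1} Q t`. -/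
theorem geometric_rrdph_pgf
    (d : ℕ) (hd : 1 ≤ d)
    (T : Matrix (Fin d) (Fin d) ℝ)
    (hT0 : ∀ i j, 0 ≤ T i j)
    (hTrow : ∀ i, ∑ j, T i j < 1)
    (q : Fin d → ℝ) (hq : ∀ i, q i ∈ Set.Ioc (0 : ℝ) 1)
    (θ1 θ2 : ℝ) (hθ1 : θ1 ∈ Set.Ico (0 : ℝ) 1) (hθ2 : θ2 ∈ Set.Icc (0 : ℝ) 1)
    (Q : Matrix (Fin d) (Fin d) ℝ) (hQ : Q = Matrix.diagonal q)
    (t : Fin d → ℝ) (ht : t = (1 - T).mulVec 1)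
    (Δ : Matrix (Fin d ⊕ Fin d) (Fin d ⊕ Fin d) ℝ)
    (hΔ : Δ = Matrix.diagonal (Sum.elim (fun _ => θ2) (fun _ => θ1)))
    (Bg : Matrix (Fin d ⊕ Fin d) (Fin d ⊕ Fin d) ℝ)
    (hBg : Bg = Matrix.fromBlocks (Q * T) (1 - Q) (Q * T) (1 - Q)) :
    IsUnit (1 - (θ2 • (Q * T) + θ1 • (1 - Q))) ∧ IsUnit (1 - Bg * Δ) ∧
      ∀ π : Fin d → ℝ,
        Sum.elim π 0 ⬝ᵥ (Δ * (1 - Bg * Δ)⁻¹).mulVec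
            (Sum.elim (Q.mulVec t) (Q.mulVec t))
          = θ2 * (π ⬝ᵥ ((1 - (θ2 • (Q * T) + θ1 • (1 - Q)))⁻¹).mulVec (Q.mulVec t)) := by
  set M := θ2 • (Q * T)
  set N := θ1 • (1 - Q)
  have hBΔ : Bg * Δ = Matrix.fromBlocks M N M N := by
    have hΔ' : Δ = Matrix.fromBlocks (θ2 • 1) 0 0 (θ1 • 1) := by
      simp [hΔ, Matrix.smul_one_eq_diagonal, Matrix.fromBlocks_diagonal]
    simp [hBg, hΔ', Matrix.fromBlocks_multiply, M, N]
  have hM : ∀ i j, M i j = θ2 * (q i * T i j) := fun i j => by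
    simp [M, hQ, Matrix.diagonal_mul]
  have hN : N = Matrix.diagonal fun i => θ1 * (1 - q i) := by
    ext i j
    rcases eq_or_ne i j with rfl | hij
    · simp [N, hQ]
    · simp [N, hQ, hij]
  have hM0 : ∀ i j, 0 ≤ M i j := fun i j => by
    rw [hM]
    exact mul_nonneg hθ2.1 (mul_nonneg (hq i).1.le (hT0 i j))
  have hN0 : ∀ i j, 0 ≤ N i j := fun i j => by
    rw [hN, Matrix.diagonal_apply]
    split_ifs
    · exact mul_nonneg hθ1.1 (sub_nonneg.2 (hq i).2)
    · exact le_rfl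
  have hrow : ∀ i, ∑ j, M i j + ∑ j, N i j < 1 := fun i => by
    have hNi : ∑ j, N i j = θ1 * (1 - q i) := by simp [hN, Matrix.diagonal_apply]
    have hMi : ∑ j, M i j = θ2 * (q i * ∑ j, T i j) := by
      simp only [hM, Finset.mul_sum]
    have hr0 : 0 ≤ q i * ∑ j, T i j :=
      mul_nonneg (hq i).1.le (Finset.sum_nonneg fun j _ => hT0 i j)
    have h1 : θ2 * (q i * ∑ j, T i j) ≤ q i * ∑ j, T i j := mul_le_of_le_one_left hr0 hθ2.2
    have h2 : q i * ∑ j, T i j < q i := mul_lt_of_lt_one_right (hq i).1 (hTrow i)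
    have h3 : θ1 * (1 - q i) ≤ 1 - q i :=
      mul_le_of_le_one_left (sub_nonneg.2 (hq i).2) hθ1.2.le
    linarith
  have hS : IsUnit (1 - (M + N)) := by
    refine Matrix.isUnit_one_sub_of_row_sum_lt_one
      (fun i j => add_nonneg (hM0 i j) (hN0 i j)) fun i => ?_
    simpa [Finset.sum_add_distrib] using hrow i
  have hB : IsUnit (1 - Bg * Δ) := by
    rw [hBΔ]
    refine Matrix.isUnit_one_sub_of_row_sum_lt_one ?_ ?_
    · rintro (i | i) (j | j)
      · exact hM0 i j
      · exact hN0 i j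
      · exact hM0 i j
      · exact hN0 i j
    · rintro (i | i) <;> simpa [Fintype.sum_sum_type] using hrow i
  refine ⟨hS, hB, fun π => ?_⟩
  set x := (1 - (M + N))⁻¹ *ᵥ (Q *ᵥ t) with hx
  have hMx : x - (M *ᵥ x + N *ᵥ x) = Q *ᵥ t := by
    have h : (1 - (M + N)) *ᵥ x = Q *ᵥ t := by
      rw [hx, Matrix.mulVec_mulVec,
        Matrix.mul_nonsing_inv _ ((Matrix.isUnit_iff_isUnit_det _).1 hS), Matrix.one_mulVec]
    simpa [Matrix.sub_mulVec, Matrix.add_mulVec] using h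
  have hv : (1 - Bg * Δ) *ᵥ Sum.elim x x = Sum.elim (Q *ᵥ t) (Q *ᵥ t) := by
    rw [hBΔ, Matrix.sub_mulVec, Matrix.one_mulVec, Matrix.fromBlocks_mulVec, ← hMx]
    ext (i | i) <;> simp
  rw [← hv, Matrix.mulVec_mulVec, Matrix.mul_assoc,
    Matrix.nonsing_inv_mul _ ((Matrix.isUnit_iff_isUnit_det _).1 hB), Matrix.mul_one, hΔ]
  simp only [dotProduct, Matrix.mulVec_diagonal, Fintype.sum_sum_type, Sum.elim_inl,
    Sum.elim_inr, Pi.zero_apply, zero_mul, Finset.sum_const_zero, add_zero, Finset.mul_sum]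
  exact Finset.sum_congr rfl fun i _ => by ring
end
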